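/- For every modal formula F, the L-labeled two-color DAG [[F]] is a modal arena. -/

import Mathlib

set_option linter.unusedVariables false

/-! ### Modal formulas -/

/-- Modal formulas: `A ::= a | A ⊃ B | A ∧ B | □A | ◇A | ◇⊥`. -/
inductive MForm : Type
  | atom : ℕ → MForm
  | imp : MForm → MForm → MForm
  | conj : MForm → MForm → MForm
  | box : MForm → MForm
  | dia : MForm → MForm
  | diaBot : MForm
deriving DecidableEq

/-- A formula is modality-free if it contains no `□` and no `◇`. -/
def MForm.ModalityFree : MForm → Prop
  | .atom _ => True
  | .imp A B => A.ModalityFree ∧ B.ModalityFree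
  | .conj A B => A.ModalityFree ∧ B.ModalityFree
  | .box _ => False
  | .dia _ => False
  | .diaBot => False

/-- A formula contains no occurrence of `◇⊥`. -/
def MForm.NoDiaBot : MForm → Prop
  | .atom _ => True
  | .imp A B => A.NoDiaBot ∧ B.NoDiaBot
  | .conj A B => A.NoDiaBot ∧ B.NoDiaBot
  | .box A => A.NoDiaBot
  | .dia A => A.NoDiaBot
  | .diaBot => False

/-! ### Sequent calculi -/

/-- A selection of the optional sequent rules. -/
structure RuleSet where
  hasC : Bool
  hasW : Bool
  hasKBox : Bool
  hasKDia : Bool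
  hasKBot : Bool
  hasD : Bool
  hasCut : Bool

def RS.IMLL : RuleSet := ⟨false, false, false, false, false, false, false⟩
def RS.LI : RuleSet := ⟨true, true, false, false, false, false, false⟩
def RS.IMLL_CK : RuleSet := ⟨false, false, true, true, true, false, false⟩
def RS.IMLL_CD : RuleSet := ⟨false, false, true, true, false, true, false⟩
def RS.LCK : RuleSet := ⟨true, true, true, true, false, false, false⟩
def RS.LCD : RuleSet := ⟨true, true, true, true, false, true, false⟩

def RuleSet.withCut (R : RuleSet) : RuleSet := { R with hasCut := true }

/-- Two-sided sequent derivability `Γ ⊢ A` from the rules selected in `R`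
(`AX`, `⊃R`, `⊃L`, `∧R`, `∧L` are always available). -/
inductive Der (R : RuleSet) : Multiset MForm → MForm → Prop
  | ax (a : ℕ) : Der R {MForm.atom a} (MForm.atom a)
  | contr {Γ : Multiset MForm} {A B : MForm} :
      R.hasC = true → Der R (A ::ₘ A ::ₘ Γ) B → Der R (A ::ₘ Γ) B
  | weak {Γ : Multiset MForm} {A B : MForm} :
      R.hasW = true → Der R Γ B → Der R (A ::ₘ Γ) B
  | impR {Γ : Multiset MForm} {A B : MForm} :
      Der R (A ::ₘ Γ) B → Der R Γ (A.imp B)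
  | impL {Γ Δ : Multiset MForm} {A B C : MForm} :
      Der R Γ A → Der R (B ::ₘ Δ) C → Der R ((A.imp B) ::ₘ (Γ + Δ)) C
  | andR {Γ Δ : Multiset MForm} {A B : MForm} :
      Der R Γ A → Der R Δ B → Der R (Γ + Δ) (A.conj B)
  | andL {Γ : Multiset MForm} {A B C : MForm} :
      Der R (A ::ₘ B ::ₘ Γ) C → Der R ((A.conj B) ::ₘ Γ) C
  | kbox {Γ : Multiset MForm} {A : MForm} :
      R.hasKBox = true → Der R Γ A → Der R (Γ.map MForm.box) (MForm.box A)
  | kdia {Γ : Multiset MForm} {A B : MForm} :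
      R.hasKDia = true → Der R (A ::ₘ Γ) B →
      Der R ((MForm.dia A) ::ₘ Γ.map MForm.box) (MForm.dia B)
  | kbot {Γ : Multiset MForm} {A : MForm} :
      R.hasKBot = true → Der R Γ A →
      Der R (MForm.diaBot ::ₘ Γ.map MForm.box) (MForm.dia A)
  | dRule {Γ : Multiset MForm} {A : MForm} :
      R.hasD = true → Der R Γ A → Der R (Γ.map MForm.box) (MForm.dia A)
  | cut {Γ Δ : Multiset MForm} {A B : MForm} :
      R.hasCut = true → Der R Γ A → Der R (A ::ₘ Δ) B → Der R (Γ + Δ) B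

/-- `F` is provable in the system `R`, i.e. the sequent `⊢ F` is derivable. -/
def SeqProvable (R : RuleSet) (F : MForm) : Prop := Der R 0 F

/-! ### The Hilbert-style logics CK and CD -/

/-- Theorems of the (disjunction-free) constructive modal logic `CK`
(for `d = false`) resp. `CD` (for `d = true`): intuitionistic axioms for
`⊃`, `∧`, the axioms `k1`, `k2` (and `d` when `d = true`), closed under
modus ponens and necessitation. -/
inductive Thm : Bool → MForm → Prop
  | axK {d : Bool} {A B : MForm} : Thm d (A.imp (B.imp A))
  | axS {d : Bool} {A B C : MForm} :
      Thm d ((A.imp (B.imp C)).imp ((A.imp B).imp (A.imp C)))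
  | axAndI {d : Bool} {A B : MForm} : Thm d (A.imp (B.imp (A.conj B)))
  | axAnd1 {d : Bool} {A B : MForm} : Thm d ((A.conj B).imp A)
  | axAnd2 {d : Bool} {A B : MForm} : Thm d ((A.conj B).imp B)
  | axk1 {d : Bool} {A B : MForm} :
      Thm d ((MForm.box (A.imp B)).imp ((MForm.box A).imp (MForm.box B)))
  | axk2 {d : Bool} {A B : MForm} :
      Thm d ((MForm.box (A.imp B)).imp ((MForm.dia A).imp (MForm.dia B)))
  | axD {A : MForm} : Thm true ((MForm.box A).imp (MForm.dia A))
  | mp {d : Bool} {A B : MForm} : Thm d (A.imp B) → Thm d A → Thm d B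
  | nec {d : Bool} {A : MForm} : Thm d A → Thm d (MForm.box A)

/-! ### Polarized formulas -/

inductive Pol : Type
  | o  -- output polarity `°`
  | i  -- input polarity `•`
deriving DecidableEq

/-- Polarized formulas (`PForm Pol.o` are the `°`-formulas, `PForm Pol.i`
the `•`-formulas). -/
inductive PForm : Pol → Type
  | atom (p : Pol) (a : ℕ) : PForm p
  | tens {p : Pol} : PForm p → PForm p → PForm p
  | limpO : PForm Pol.i → PForm Pol.o → PForm Pol.o
  | limpI : PForm Pol.o → PForm Pol.i → PForm Pol.i
  | box {p : Pol} : PForm p → PForm p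
  | dia {p : Pol} : PForm p → PForm p
  | diaBot : PForm Pol.i

/-- `⌊H⌋`: erase polarities, replacing `⊗` by `∧` and `⊸` by `⊃`. -/
def PForm.floor : {p : Pol} → PForm p → MForm
  | _, .atom _ a => .atom a
  | _, .tens A B => .conj A.floor B.floor
  | _, .limpO A B => .imp A.floor B.floor
  | _, .limpI A B => .imp A.floor B.floor
  | _, .box A => .box A.floor
  | _, .dia A => .dia A.floor
  | _, .diaBot => .diaBot

/-- One-sided polarized sequent derivability `Γ•, A°` from the rules
selected in `R` (the polarized versions of the two-sided rules). -/
inductive PDer (R : RuleSet) : Multiset (PForm Pol.i) → PForm Pol.o → Prop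
  | ax (a : ℕ) : PDer R {PForm.atom Pol.i a} (PForm.atom Pol.o a)
  | contr {Γ : Multiset (PForm Pol.i)} {A : PForm Pol.i} {B : PForm Pol.o} :
      R.hasC = true → PDer R (A ::ₘ A ::ₘ Γ) B → PDer R (A ::ₘ Γ) B
  | weak {Γ : Multiset (PForm Pol.i)} {A : PForm Pol.i} {B : PForm Pol.o} :
      R.hasW = true → PDer R Γ B → PDer R (A ::ₘ Γ) B
  | impO {Γ : Multiset (PForm Pol.i)} {A : PForm Pol.i} {B : PForm Pol.o} :
      PDer R (A ::ₘ Γ) B → PDer R Γ (PForm.limpO A B)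
  | impI {Γ Δ : Multiset (PForm Pol.i)} {A : PForm Pol.o} {B : PForm Pol.i}
      {C : PForm Pol.o} :
      PDer R Γ A → PDer R (B ::ₘ Δ) C → PDer R ((PForm.limpI A B) ::ₘ (Γ + Δ)) C
  | tensO {Γ Δ : Multiset (PForm Pol.i)} {A B : PForm Pol.o} :
      PDer R Γ A → PDer R Δ B → PDer R (Γ + Δ) (PForm.tens A B)
  | tensI {Γ : Multiset (PForm Pol.i)} {A B : PForm Pol.i} {C : PForm Pol.o} :
      PDer R (A ::ₘ B ::ₘ Γ) C → PDer R ((PForm.tens A B) ::ₘ Γ) C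
  | kbox {Γ : Multiset (PForm Pol.i)} {A : PForm Pol.o} :
      R.hasKBox = true → PDer R Γ A → PDer R (Γ.map PForm.box) (PForm.box A)
  | kdia {Γ : Multiset (PForm Pol.i)} {A : PForm Pol.i} {B : PForm Pol.o} :
      R.hasKDia = true → PDer R (A ::ₘ Γ) B →
      PDer R ((PForm.dia A) ::ₘ Γ.map PForm.box) (PForm.dia B)
  | kbot {Γ : Multiset (PForm Pol.i)} {A : PForm Pol.o} :
      R.hasKBot = true → PDer R Γ A →
      PDer R (PForm.diaBot ::ₘ Γ.map PForm.box) (PForm.dia A)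
  | dRule {Γ : Multiset (PForm Pol.i)} {A : PForm Pol.o} :
      R.hasD = true → PDer R Γ A → PDer R (Γ.map PForm.box) (PForm.dia A)

/-- The P-formula `H` is provable in the polarized system `R`. -/
def PProvable (R : RuleSet) (H : PForm Pol.o) : Prop := PDer R 0 H

/-! ### Deep inference rules `↓POL-LI` -/

/-- One step of deep rewriting with a rule of `↓POL-LI`
(`w◇`, `w⊗`, `w⊸`, deep `c•`), inside an arbitrary polarized context. -/
inductive DeepStep : {p : Pol} → PForm p → PForm p → Prop
  | wdia (A : PForm Pol.i) : DeepStep PForm.diaBot (PForm.dia A)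
  | wtens (A B : PForm Pol.i) : DeepStep A (PForm.tens A B)
  | wlimp (A : PForm Pol.o) (B : PForm Pol.i) : DeepStep A (PForm.limpO B A)
  | ctr (A : PForm Pol.i) : DeepStep (PForm.tens A A) A
  | tensL {p : Pol} {A A' B : PForm p} :
      DeepStep A A' → DeepStep (PForm.tens A B) (PForm.tens A' B)
  | tensR {p : Pol} {A B B' : PForm p} :
      DeepStep B B' → DeepStep (PForm.tens A B) (PForm.tens A B')
  | limpOL {A A' : PForm Pol.i} {B : PForm Pol.o} :
      DeepStep A A' → DeepStep (PForm.limpO A B) (PForm.limpO A' B)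
  | limpOR {A : PForm Pol.i} {B B' : PForm Pol.o} :
      DeepStep B B' → DeepStep (PForm.limpO A B) (PForm.limpO A B')
  | limpIL {A A' : PForm Pol.o} {B : PForm Pol.i} :
      DeepStep A A' → DeepStep (PForm.limpI A B) (PForm.limpI A' B)
  | limpIR {A : PForm Pol.o} {B B' : PForm Pol.i} :
      DeepStep B B' → DeepStep (PForm.limpI A B) (PForm.limpI A B')
  | boxC {p : Pol} {A A' : PForm p} :
      DeepStep A A' → DeepStep (PForm.box A) (PForm.box A')
  | diaC {p : Pol} {A A' : PForm p} :
      DeepStep A A' → DeepStep (PForm.dia A) (PForm.dia A')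

/-- There is a derivation from `H'` to `H` using only rules of `↓POL-LI`. -/
def DeepDer (H' H : PForm Pol.o) : Prop :=
  Relation.ReflTransGen (@DeepStep Pol.o) H' H

/-! ### Labeled graphs -/

/-- The label set `L = 𝒜 ∪ {□, ◇}`. -/
inductive MLabel : Type
  | atom : ℕ → MLabel
  | box : MLabel
  | dia : MLabel
deriving DecidableEq

/-- `pathN r n v w`: there is an `r`-path of length `n` from `v` to `w`. -/
def pathN {V : Type} (r : V → V → Prop) : ℕ → V → V → Prop
  | 0 => fun v w => v = w
  | n + 1 => fun v w => ∃ u, r v u ∧ pathN r n u w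

/-- An `L`-labeled directed graph. -/
structure LDigraph where
  V : Type
  vfin : Finite V
  edge : V → V → Prop
  label : V → MLabel

/-- An arena: a nonempty `L`-labeled DAG which is L-free and Σ-free. -/
def LDigraph.IsArena (G : LDigraph) : Prop :=
  Nonempty G.V ∧
  (∀ v, ¬ Relation.TransGen G.edge v v) ∧
  (∀ a u w v, G.edge a u → G.edge a w → G.edge w v → G.edge u v) ∧
  (∀ a v w b u, G.edge a v → G.edge a w → G.edge b w → G.edge b u →
    G.edge a u ∨ G.edge b v)

/-- Isomorphism of `L`-labeled directed graphs. -/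
structure LDigraph.Iso (G H : LDigraph) where
  e : G.V ≃ H.V
  edge_iff : ∀ v w, G.edge v w ↔ H.edge (e v) (e w)
  label_eq : ∀ v, H.label (e v) = G.label v

/-- An `L`-labeled graph with two kinds of edges `→` (`iedge`) and
`⇢` (`medge`). -/
structure LGraph where
  V : Type
  vfin : Finite V
  iedge : V → V → Prop
  medge : V → V → Prop
  label : V → MLabel

/-- Forget the `⇢`-edges. -/
def LGraph.toDigraph (G : LGraph) : LDigraph := ⟨G.V, G.vfin, G.iedge, G.label⟩

/-- `G` is a two-color DAG: the edge sets are disjoint and their union is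
acyclic. -/
def LGraph.IsTwoColor (G : LGraph) : Prop :=
  (∀ v w, ¬ (G.iedge v w ∧ G.medge v w)) ∧
  (∀ v, ¬ Relation.TransGen (fun a b => G.iedge a b ∨ G.medge a b) v v)

def LGraph.iRoot (G : LGraph) (v : G.V) : Prop := ∀ w, ¬ G.iedge v w

def LGraph.mRoot (G : LGraph) (v : G.V) : Prop := ∀ w, ¬ G.medge v w

def LGraph.istar (G : LGraph) : G.V → G.V → Prop := Relation.ReflTransGen G.iedge

/-- `(V, →)` is an arena. -/
def LGraph.IsArena (G : LGraph) : Prop :=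
  Nonempty G.V ∧
  (∀ v, ¬ Relation.TransGen G.iedge v v) ∧
  (∀ a u w v, G.iedge a u → G.iedge a w → G.iedge w v → G.iedge u v) ∧
  (∀ a v w b u, G.iedge a v → G.iedge a w → G.iedge b w → G.iedge b u →
    G.iedge a u ∨ G.iedge b v)

/-- Modal arena. -/
def LGraph.IsModalArena (G : LGraph) : Prop :=
  G.IsTwoColor ∧ G.IsArena ∧
  (∀ v w u, G.medge v w → G.medge w u → G.medge v u) ∧
  (∀ v w u, G.medge v w → G.medge u w → (G.medge u v ∨ G.medge v u ∨ u = v)) ∧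
  (∀ v w u, G.medge v w → G.medge v u → ¬ G.iedge u w) ∧
  (∀ v w u, G.medge v w → G.iedge u v → G.iedge u w) ∧
  (∀ v w u, G.medge v w → G.iedge v u → G.iedge w u) ∧
  (∀ v w u, G.medge v w → G.iedge w u → G.iedge v u) ∧
  (∀ v w, G.medge v w → (G.label v = MLabel.box ∨ G.label v = MLabel.dia)) ∧
  (∀ v, G.label v = MLabel.box → ∃ w, G.medge v w)

def LGraph.atomicV (G : LGraph) (v : G.V) : Prop := ∃ a, G.label v = MLabel.atom a

def LGraph.modalV (G : LGraph) (v : G.V) : Prop :=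
  G.label v = MLabel.box ∨ G.label v = MLabel.dia

/-! ### Operations on labeled graphs and the translation `[[·]]` -/

def sumRel {A B : Type} (r : A → A → Prop) (s : B → B → Prop) :
    A ⊕ B → A ⊕ B → Prop
  | Sum.inl x, Sum.inl y => r x y
  | Sum.inr x, Sum.inr y => s x y
  | _, _ => False

/-- Disjoint union `G + H`. -/
def LGraph.gsum (G H : LGraph) : LGraph where
  V := G.V ⊕ H.V
  vfin := by haveI := G.vfin; haveI := H.vfin; exact inferInstance
  iedge := sumRel G.iedge H.iedge
  medge := sumRel G.medge H.medge
  label := Sum.elim G.label H.label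

/-- `G ▹ H`: disjoint union plus a `→`-edge from every `→`-root of `G` to
every `→`-root of `H`. -/
def LGraph.bef (G H : LGraph) : LGraph where
  V := G.V ⊕ H.V
  vfin := by haveI := G.vfin; haveI := H.vfin; exact inferInstance
  iedge := fun a b => sumRel G.iedge H.iedge a b ∨
    (∃ (x : G.V) (y : H.V), a = Sum.inl x ∧ b = Sum.inr y ∧ G.iRoot x ∧ H.iRoot y)
  medge := sumRel G.medge H.medge
  label := Sum.elim G.label H.label

/-- `G ▹⇢ H`: disjoint union plus a `⇢`-edge from every `→`-root of `G` to
every `→`-root of `H`. -/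
def LGraph.mbef (G H : LGraph) : LGraph where
  V := G.V ⊕ H.V
  vfin := by haveI := G.vfin; haveI := H.vfin; exact inferInstance
  iedge := sumRel G.iedge H.iedge
  medge := fun a b => sumRel G.medge H.medge a b ∨
    (∃ (x : G.V) (y : H.V), a = Sum.inl x ∧ b = Sum.inr y ∧ G.iRoot x ∧ H.iRoot y)
  label := Sum.elim G.label H.label

/-- The single-vertex graph with label `l`. -/
def LGraph.single (l : MLabel) : LGraph where
  V := Unit
  vfin := inferInstance
  iedge := fun _ _ => False
  medge := fun _ _ => False
  label := fun _ => l

/-- The translation `[[·]]` from modal formulas to `L`-labeled two-color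
DAGs. -/
def MForm.arena : MForm → LGraph
  | .atom a => LGraph.single (MLabel.atom a)
  | .diaBot => LGraph.single MLabel.dia
  | .conj A B => A.arena.gsum B.arena
  | .imp A B => A.arena.bef B.arena
  | .box A => (LGraph.single MLabel.box).mbef A.arena
  | .dia A => (LGraph.single MLabel.dia).mbef A.arena

/-- Isomorphism of `L`-labeled two-color DAGs. -/
structure LGraph.Iso (G H : LGraph) where
  e : G.V ≃ H.V
  iedge_iff : ∀ v w, G.iedge v w ↔ H.iedge (e v) (e w)
  medge_iff : ∀ v w, G.medge v w ↔ H.medge (e v) (e w)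
  label_eq : ∀ v, H.label (e v) = G.label v

/-! ### Depth, meeting points, skew fibrations -/

/-- The depth of `v`: the length of the longest `→`-path from `v` to a
`→`-root. -/
noncomputable def LGraph.depth (G : LGraph) (v : G.V) : ℕ :=
  sSup {n : ℕ | ∃ w, pathN G.iedge n v w ∧ G.iRoot w}

/-- `u` is a meeting point of `v` and `w`. -/
def LGraph.IsMeet (G : LGraph) (v w u : G.V) : Prop :=
  G.istar v u ∧ G.istar w u ∧
  ∀ u', G.istar v u' → G.istar w u' → G.istar u u'

/-- `v` and `w` are conjunct: distinct, with odd meeting depth. -/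
def LGraph.Conj (G : LGraph) (v w : G.V) : Prop :=
  v ≠ w ∧ ∃ u, G.IsMeet v w u ∧ ¬ Even (G.depth u) ∧
    ∀ u', G.IsMeet v w u' → G.depth u ≤ G.depth u'

/-- `v` and `w` are disjunct: distinct, with even meeting depth. -/
def LGraph.Disj (G : LGraph) (v w : G.V) : Prop :=
  v ≠ w ∧ ∃ u, G.IsMeet v w u ∧ Even (G.depth u) ∧
    ∀ u', G.IsMeet v w u' → G.depth u ≤ G.depth u'

/-- Arena homomorphism: preserves `→`, `⇢`, depth and labels. -/
def IsHom (H G : LGraph) (f : H.V → G.V) : Prop :=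
  (∀ v w, H.iedge v w → G.iedge (f v) (f w)) ∧
  (∀ v w, H.medge v w → G.medge (f v) (f w)) ∧
  (∀ v, H.depth v = G.depth (f v)) ∧
  (∀ v, H.label v = G.label (f v))

/-- Modal arena homomorphism. -/
def IsModalHom (H G : LGraph) (f : H.V → G.V) : Prop :=
  IsHom H G f ∧ ∀ v u, G.medge (f v) (f u) → ∃ w, H.medge w u ∧ f w = f v

/-- (Even) skew fibration. -/
def IsSkewFib (H G : LGraph) (f : H.V → G.V) : Prop :=
  IsModalHom H G f ∧
  (∀ v w, H.Conj v w → G.Conj (f v) (f w)) ∧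
  (∀ v w, G.Conj (f v) w → ∃ u, H.Conj v u ∧ ¬ G.Conj (f u) w)

/-- Odd skew fibration. -/
def IsOddSkewFib (H G : LGraph) (f : H.V → G.V) : Prop :=
  IsModalHom H G f ∧
  (∀ v w, H.Disj v w → G.Disj (f v) (f w)) ∧
  (∀ v w, G.Disj (f v) w → ∃ u, H.Disj v u ∧ ¬ G.Disj (f u) w)

/-! ### Arena nets -/

/-- The `⇢`-cone of a modal vertex `m`. -/
def LGraph.mcone (G : LGraph) (m : G.V) : Set G.V :=
  {w | ∃ u, G.medge m u ∧ G.istar w u ∧ ¬ G.istar w m}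

/-- `m` is the principal modal vertex of `v` (`m = p(v)`). -/
def LGraph.IsPrincipal (G : LGraph) (v m : G.V) : Prop :=
  (v ∈ G.mcone m ∧ ∀ m', v ∈ G.mcone m' → m' ≠ m → m ∈ G.mcone m') ∨
  (m = v ∧ ∀ m', v ∉ G.mcone m')

/-- The `→`-edge `v → w` is a chord. -/
def LGraph.IsChord (G : LGraph) (v w : G.V) : Prop :=
  G.iedge v w ∧
  ((∃ u, G.iedge v u ∧ G.medge u w) ∨ (∃ u, G.iedge u w ∧ G.medge u v))

/-- `⤳o`: odd non-chord `→`-edges. -/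
def LGraph.oE (G : LGraph) (v w : G.V) : Prop :=
  G.iedge v w ∧ ¬ Even (G.depth w) ∧ ¬ G.IsChord v w

/-- `⤳m`: edges `(v, p(v))` with `p(v) ≠ v` and `v` even or `p(v)` odd. -/
def LGraph.mE (G : LGraph) (v w : G.V) : Prop :=
  G.IsPrincipal v w ∧ w ≠ v ∧ (Even (G.depth v) ∨ ¬ Even (G.depth w))

/-- `⤳≈`: from odd vertices to the even vertex of their `≈`-class. -/
def axE (G : LGraph) (ax : G.V → G.V → Prop) (v w : G.V) : Prop :=
  ¬ Even (G.depth v) ∧ Even (G.depth w) ∧ ax v w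

/-- Edges of the linking graph `λ(G)`. -/
def lkE (G : LGraph) (ax : G.V → G.V → Prop) (v w : G.V) : Prop :=
  G.oE v w ∨ G.mE v w ∨ axE G ax v w

/-- Checked paths in the linking graph. -/
def Checked (G : LGraph) (ax : G.V → G.V → Prop) (p : List G.V) : Prop :=
  List.Chain' (lkE G ax) p ∧
  (∀ v, p.head? = some v → (G.iRoot v ∧ G.mRoot v)) ∧
  List.Chain' (fun v w => axE G ax v w → G.mcone v = ∅) p

/-- `ax` makes `G` a partitioned modal arena. -/
def IsPartitioned (G : LGraph) (ax : G.V → G.V → Prop) : Prop :=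
  Equivalence ax ∧
  (∀ v w, G.atomicV v → ax v w → (G.atomicV w ∧ G.label v = G.label w)) ∧
  (∀ v, G.atomicV v → ∃ w, w ≠ v ∧ ax v w ∧ ∀ u, ax v u → u = v ∨ u = w)

/-- Linked: every `≈`-class has exactly one even vertex. -/
def Linked (G : LGraph) (ax : G.V → G.V → Prop) : Prop :=
  ∀ v, ∃ w, ax v w ∧ Even (G.depth w) ∧
    ∀ u, ax v u → Even (G.depth u) → u = w

def NetAcyclic (G : LGraph) (ax : G.V → G.V → Prop) : Prop :=
  ∀ p, Checked G ax p → p.Nodup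

def NetFunctional (G : LGraph) (ax : G.V → G.V → Prop) : Prop :=
  ∀ p, Checked G ax p → ∀ v ∈ p, ¬ Even (G.depth v) →
    ∃ w ∈ p, Even (G.depth w) ∧ G.iedge v w

def NetFunctorial (G : LGraph) (ax : G.V → G.V → Prop) : Prop :=
  ∀ v w w', G.medge v w → ax w w' → ∃ v', ax v v' ∧ G.medge v' w'

/-- CK-arena net. -/
def IsCKNet (G : LGraph) (ax : G.V → G.V → Prop) : Prop :=
  G.IsModalArena ∧ Nonempty G.V ∧ IsPartitioned G ax ∧ Linked G ax ∧
  NetAcyclic G ax ∧ NetFunctional G ax ∧ NetFunctorial G ax ∧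
  (∀ v, G.modalV v → (∀ w, ¬ G.medge v w) → G.label v = MLabel.dia) ∧
  (∀ w, G.modalV w → Even (G.depth w) →
    ((∀ v, ax v w → G.label v = MLabel.box) ∨
     (G.label w = MLabel.dia ∧
       ∃! v, ax v w ∧ ¬ Even (G.depth v) ∧ G.label v = MLabel.dia)))

/-- CD-arena net. -/
def IsCDNet (G : LGraph) (ax : G.V → G.V → Prop) : Prop :=
  G.IsModalArena ∧ Nonempty G.V ∧ IsPartitioned G ax ∧ Linked G ax ∧
  NetAcyclic G ax ∧ NetFunctional G ax ∧ NetFunctorial G ax ∧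
  (∀ v, G.modalV v → ∃ w, G.medge v w) ∧
  (∀ w, G.modalV w → Even (G.depth w) →
    ((∀ v, ax v w → G.label v = MLabel.box) ∨
     (G.label w = MLabel.dia ∧
       ∀ v v', (ax v w ∧ ¬ Even (G.depth v) ∧ G.label v = MLabel.dia) →
               (ax v' w ∧ ¬ Even (G.depth v') ∧ G.label v' = MLabel.dia) →
               v = v')))

/-- `X`-arena net, `d = false` for `X = CK` and `d = true` for `X = CD`. -/
def IsNet (d : Bool) (G : LGraph) (ax : G.V → G.V → Prop) : Prop :=
  if d then IsCDNet G ax else IsCKNet G ax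

/-! ### Formula isomorphism -/

/-- The smallest congruence on modal formulas containing commutativity and
associativity of `∧` and currying. -/
inductive FEq : MForm → MForm → Prop
  | comm (A B : MForm) : FEq (A.conj B) (B.conj A)
  | assoc (A B C : MForm) : FEq (A.conj (B.conj C)) ((A.conj B).conj C)
  | curry (A B C : MForm) : FEq ((A.conj B).imp C) (A.imp (B.imp C))
  | refl (A : MForm) : FEq A A
  | symm {A B : MForm} : FEq A B → FEq B A
  | trans {A B C : MForm} : FEq A B → FEq B C → FEq A C
  | impC {A A' B B' : MForm} : FEq A A' → FEq B B' → FEq (A.imp B) (A'.imp B')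
  | conjC {A A' B B' : MForm} : FEq A A' → FEq B B' → FEq (A.conj B) (A'.conj B')
  | boxC {A A' : MForm} : FEq A A' → FEq (MForm.box A) (MForm.box A')
  | diaC {A A' : MForm} : FEq A A' → FEq (MForm.dia A) (MForm.dia A')

/-! ### Views and winning innocent strategies -/

/-- A view on a modal arena. -/
def IsView (G : LGraph) (p : List G.V) : Prop :=
  p.Nodup ∧
  (∀ v, p.head? = some v → G.iRoot v) ∧
  (∀ i : Fin p.length, i.val ≠ 0 →
    ∃ j : Fin p.length, j.val < i.val ∧ G.iedge (p.get i) (p.get j)) ∧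
  (∀ (i : ℕ) (h : i + 1 < p.length),
    (Even (G.depth (p.get ⟨i + 1, h⟩)) ∧
        ¬ Even (G.depth (p.get ⟨i, Nat.lt_of_succ_lt h⟩)) →
      G.iedge (p.get ⟨i + 1, h⟩) (p.get ⟨i, Nat.lt_of_succ_lt h⟩)) ∧
    (¬ Even (G.depth (p.get ⟨i + 1, h⟩)) ∧
        Even (G.depth (p.get ⟨i, Nat.lt_of_succ_lt h⟩)) →
      G.label (p.get ⟨i + 1, h⟩) = G.label (p.get ⟨i, Nat.lt_of_succ_lt h⟩))) ∧
  (∀ v ∈ p, G.atomicV v ∨ G.label v = MLabel.dia)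

/-- Winning innocent strategy on `G`. -/
def IsWIS (G : LGraph) (S : Set (List G.V)) : Prop :=
  S.Finite ∧
  (∀ p ∈ S, IsView G p) ∧
  (∀ p ∈ S, p.dropLast ∈ S) ∧
  (∀ p ∈ S, Even p.length → ∀ v, IsView G (p ++ [v]) → (p ++ [v]) ∈ S) ∧
  (∀ p ∈ S, ¬ Even p.length → ∃! v, (p ++ [v]) ∈ S) ∧
  (∀ v, G.label v = MLabel.dia → Even (G.depth v) → (∃ p ∈ S, v ∈ p) →
    ((∃ w, G.medge v w) ∧ ∀ w, G.medge v w → ∃ q ∈ S, w ∈ q))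

/-- Atomic strategy: all moves are labeled by propositional variables. -/
def AtomicWIS (G : LGraph) (S : Set (List G.V)) : Prop :=
  ∀ p ∈ S, ∀ v ∈ p, G.atomicV v

/-- `IsAddr G v l`: `l` is the address of `v`. -/
inductive IsAddr (G : LGraph) : G.V → List G.V → Prop
  | nil (v : G.V) : G.IsPrincipal v v → IsAddr G v []
  | cons {v m : G.V} {l : List G.V} :
      G.IsPrincipal v m → m ≠ v → IsAddr G m l → IsAddr G v (m :: l)

/-- Well-framed view: consecutive moves `p_{2k}`, `p_{2k+1}` have addresses
of the same length. -/
def WellFramed (G : LGraph) (p : List G.V) : Prop :=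
  ∀ (k : ℕ) (h : 2 * k + 1 < p.length) (l1 l2 : List G.V),
    IsAddr G (p.get ⟨2 * k, by omega⟩) l1 →
    IsAddr G (p.get ⟨2 * k + 1, h⟩) l2 → l1.length = l2.length

/-- A framed view of `p`: a choice of address and blank-height for each
column. -/
structure Framing (G : LGraph) (p : List G.V) where
  addr : Fin p.length → List G.V
  addr_ok : ∀ i, IsAddr G (p.get i) (addr i)
  ht : Fin p.length → ℕ

/-- The entry of the framed view in column `i`, row `r`. -/
def frEntry {G : LGraph} {p : List G.V} (fr : Framing G p)
    (i : Fin p.length) (r : ℕ) : Option G.V :=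
  if r = 0 then some (p.get i)
  else if r ≤ fr.ht i then none
  else (fr.addr i)[r - fr.ht i - 1]?

/-- Generating relation of `≈_p`: non-blank entries in the same row of
columns `2k` and `2k+1`. -/
def frRel {G : LGraph} {p : List G.V} (fr : Framing G p) (u w : G.V) : Prop :=
  ∃ (k r : ℕ) (h : 2 * k + 1 < p.length),
    frEntry fr ⟨2 * k, by omega⟩ r = some u ∧ frEntry fr ⟨2 * k + 1, h⟩ r = some w

/-- Equivalence generated by a relation. -/
inductive REqvGen {V : Type} (r : V → V → Prop) : V → V → Prop
  | rel {x y : V} : r x y → REqvGen r x y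
  | refl (x : V) : REqvGen r x x
  | symm {x y : V} : REqvGen r x y → REqvGen r y x
  | trans {x y z : V} : REqvGen r x y → REqvGen r y z → REqvGen r x z

/-- The equivalence relation `≈_p` induced by a framed view. -/
def frEq {G : LGraph} {p : List G.V} (fr : Framing G p) : G.V → G.V → Prop :=
  REqvGen (frRel fr)

/-- A vertex is involved in a framed view if it occurs among its entries. -/
def frInv {G : LGraph} {p : List G.V} (fr : Framing G p) (v : G.V) : Prop :=
  ∃ (i : Fin p.length) (r : ℕ), frEntry fr i r = some v

/-- CK-WIS: a well-framed linked WIS satisfying the CK frame conditions. -/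
def IsCKWIS (G : LGraph) (S : Set (List G.V)) : Prop :=
  IsWIS G S ∧ (∀ p ∈ S, WellFramed G p) ∧
  ∃ fr : ∀ p, p ∈ S → Framing G p,
    (∀ p (h : p ∈ S), ∀ v, frInv (fr p h) v →
      ∃ w, frEq (fr p h) v w ∧ Even (G.depth w) ∧
        ∀ u, frEq (fr p h) v u → Even (G.depth u) → u = w) ∧
    (∀ w, G.modalV w → Even (G.depth w) → (∃ p h, frInv (fr p h) w) →
      ((G.label w = MLabel.box →
        ∀ v, (¬ Even (G.depth v) ∧ Even (G.depth w) ∧ ∃ p h, frEq (fr p h) v w) →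
          G.label v = MLabel.box) ∧
       (G.label w = MLabel.dia →
        ∃! v, (¬ Even (G.depth v) ∧ Even (G.depth w) ∧ ∃ p h, frEq (fr p h) v w) ∧
          G.label v = MLabel.dia)))

/-- CD-WIS: a well-framed linked atomic WIS satisfying the CD frame
conditions. -/
def IsCDWIS (G : LGraph) (S : Set (List G.V)) : Prop :=
  IsWIS G S ∧ AtomicWIS G S ∧ (∀ p ∈ S, WellFramed G p) ∧
  ∃ fr : ∀ p, p ∈ S → Framing G p,
    (∀ p (h : p ∈ S), ∀ v, frInv (fr p h) v →
      ∃ w, frEq (fr p h) v w ∧ Even (G.depth w) ∧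
        ∀ u, frEq (fr p h) v u → Even (G.depth u) → u = w) ∧
    (∀ w, G.modalV w → Even (G.depth w) → (∃ p h, frInv (fr p h) w) →
      ((G.label w = MLabel.box →
        ∀ v, (¬ Even (G.depth v) ∧ Even (G.depth w) ∧ ∃ p h, frEq (fr p h) v w) →
          G.label v = MLabel.box) ∧
       (G.label w = MLabel.dia →
        ∀ v v',
          ((¬ Even (G.depth v) ∧ Even (G.depth w) ∧ ∃ p h, frEq (fr p h) v w) ∧
            G.label v = MLabel.dia) →
          ((¬ Even (G.depth v') ∧ Even (G.depth w) ∧ ∃ p h, frEq (fr p h) v' w) ∧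
            G.label v' = MLabel.dia) → v = v')))

/-- `X`-WIS, `d = false` for `X = CK` and `d = true` for `X = CD`. -/
def IsXWIS (d : Bool) (G : LGraph) (S : Set (List G.V)) : Prop :=
  if d then IsCDWIS G S else IsCKWIS G S

/-! ### Abstract views of an arena net -/

def LGraph.isAtomB (G : LGraph) (v : G.V) : Bool :=
  match G.label v with
  | MLabel.atom _ => true
  | _ => false

/-- `⌊s⌋`: the subsequence of atomic vertices of `s`. -/
def atomFilter (G : LGraph) (s : List G.V) : List G.V := s.filter G.isAtomB

/-- `Abs G ax s q`: `q` is an abstract view obtained from the framed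
abstract view `s`. -/
inductive Abs (G : LGraph) (ax : G.V → G.V → Prop) : List G.V → List G.V → Prop
  | base (s : List G.V) : Abs G ax s (atomFilter G s)
  | pair (s1 : List G.V) (v w : G.V) (s2 rest q : List G.V) :
      G.label v = MLabel.dia → G.label w = MLabel.dia → axE G ax v w →
      Abs G ax rest q →
      Abs G ax (s1 ++ v :: (s2 ++ w :: rest)) (atomFilter G s1 ++ v :: w :: q)

/-- Abstract views of the arena net `(G, ax)`: abstractions of framed
abstract views, i.e. of reversed checked paths of `λ(G)`. -/
def IsAbsView (G : LGraph) (ax : G.V → G.V → Prop) (q : List G.V) : Prop :=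
  ∃ s : List G.V, Checked G ax s.reverse ∧ Abs G ax s q

/-! ### Forms of skew fibrations -/

/-- `f` is (up to isomorphism) an identity `id_G`. -/
def FormIdF (H G : LGraph) (f : H.V → G.V) : Prop :=
  ∃ e : LGraph.Iso H G, ∀ v, f v = e.e v

/-- `f` is (up to isomorphism) of the form `f1 + f2`. -/
def FormSum (P Q : ∀ (H G : LGraph), (H.V → G.V) → Prop)
    (H G : LGraph) (f : H.V → G.V) : Prop :=
  ∃ (H1 H2 G1 G2 : LGraph) (f1 : H1.V → G1.V) (f2 : H2.V → G2.V),
    P H1 G1 f1 ∧ Q H2 G2 f2 ∧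
    ∃ (eH : LGraph.Iso H (H1.gsum H2)) (eG : LGraph.Iso G (G1.gsum G2)),
      ∀ v, eG.e (f v) = Sum.map f1 f2 (eH.e v)

/-- `f` is (up to isomorphism) of the form `f1 ▹ f2`. -/
def FormBef (P Q : ∀ (H G : LGraph), (H.V → G.V) → Prop)
    (H G : LGraph) (f : H.V → G.V) : Prop :=
  ∃ (H1 H2 G1 G2 : LGraph) (f1 : H1.V → G1.V) (f2 : H2.V → G2.V),
    P H1 G1 f1 ∧ Q H2 G2 f2 ∧
    ∃ (eH : LGraph.Iso H (H1.bef H2)) (eG : LGraph.Iso G (G1.bef G2)),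
      ∀ v, eG.e (f v) = Sum.map f1 f2 (eH.e v)

/-- `f` is (up to isomorphism) of the form `id_v ▹⇢ f2` for a single modal
vertex `v`. -/
def FormMBef (Q : ∀ (H G : LGraph), (H.V → G.V) → Prop)
    (H G : LGraph) (f : H.V → G.V) : Prop :=
  ∃ l : MLabel, (l = MLabel.box ∨ l = MLabel.dia) ∧
    ∃ (H2 G2 : LGraph) (f2 : H2.V → G2.V), Q H2 G2 f2 ∧
      ∃ (eH : LGraph.Iso H ((LGraph.single l).mbef H2))
        (eG : LGraph.Iso G ((LGraph.single l).mbef G2)),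
        ∀ v, eG.e (f v) = Sum.map id f2 (eH.e v)

/-- `f` is (up to isomorphism) a pairing `⟨f1, f2⟩` into a common target. -/
def FormPair (P Q : ∀ (H G : LGraph), (H.V → G.V) → Prop)
    (H G : LGraph) (f : H.V → G.V) : Prop :=
  ∃ (H1 H2 : LGraph) (f1 : H1.V → G.V) (f2 : H2.V → G.V),
    P H1 G f1 ∧ Q H2 G f2 ∧
    ∃ eH : LGraph.Iso H (H1.gsum H2), ∀ v, f v = Sum.elim f1 f2 (eH.e v)

/-- A relation on a sum that never goes from right to left has no cycle if neither of its two
restrictions has one. -/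
theorem acyclic_sum {A B : Type} {r : A → A → Prop} {s : B → B → Prop} {R : A ⊕ B → A ⊕ B → Prop}
    (hl : ∀ x y, R (Sum.inl x) (Sum.inl y) → r x y)
    (hr : ∀ x y, R (Sum.inr x) (Sum.inr y) → s x y)
    (hrl : ∀ x y, ¬ R (Sum.inr x) (Sum.inl y))
    (hA : ∀ v, ¬ Relation.TransGen r v v) (hB : ∀ v, ¬ Relation.TransGen s v v) (v : A ⊕ B) :
    ¬ Relation.TransGen R v v := by
  have from_right : ∀ x b, Relation.TransGen R (Sum.inr x) b →
      ∃ y, b = Sum.inr y ∧ Relation.TransGen s x y := by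
    intro x b h
    induction h with
    | @single b h =>
      cases b with
      | inl y => exact absurd h (hrl _ _)
      | inr y => exact ⟨y, rfl, .single (hr _ _ h)⟩
    | @tail b c _ h ih =>
      obtain ⟨y, rfl, hy⟩ := ih
      cases c with
      | inl z => exact absurd h (hrl _ _)
      | inr z => exact ⟨z, rfl, hy.tail (hr _ _ h)⟩
  have to_left : ∀ a y, Relation.TransGen R a (Sum.inl y) →
      ∃ x, a = Sum.inl x ∧ Relation.TransGen r x y := by
    intro a y h
    induction h using Relation.TransGen.head_induction_on with
    | @single a h =>
      cases a with
      | inl x => exact ⟨x, rfl, .single (hl _ _ h)⟩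
      | inr x => exact absurd h (hrl _ _)
    | @head a b h _ ih =>
      obtain ⟨z, rfl, hz⟩ := ih
      cases a with
      | inl x => exact ⟨x, rfl, hz.head (hl _ _ h)⟩
      | inr x => exact absurd h (hrl _ _)
  intro h
  cases v with
  | inl x =>
    obtain ⟨y, hy, h⟩ := to_left _ _ h
    cases hy
    exact hA _ h
  | inr x =>
    obtain ⟨y, hy, h⟩ := from_right _ _ h
    cases hy
    exact hB _ h

namespace LGraph

theorem IsTwoColor.acyclic_iedge {G : LGraph} (h : G.IsTwoColor) (v : G.V) :
    ¬ Relation.TransGen G.iedge v v :=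
  fun hv => h.2 v (Relation.TransGen.mono (fun _ _ => Or.inl) _ _ hv)

theorem isModalArena_single {l : MLabel} (hl : l ≠ MLabel.box) : (single l).IsModalArena := by
  have acyclic : ∀ r : Unit → Unit → Prop, (∀ x y, ¬ r x y) → ∀ v, ¬ Relation.TransGen r v v := by
    intro r hr v h
    cases h with
    | single h => exact hr _ _ h
    | tail _ h => exact hr _ _ h
  refine ⟨⟨?_, acyclic _ ?_⟩, ⟨⟨()⟩, acyclic _ ?_, ?_, ?_⟩, ?_⟩ <;> simp [single, hl]

theorem IsModalArena.gsum {G H : LGraph} (hG : G.IsModalArena) (hH : H.IsModalArena) :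
    (G.gsum H).IsModalArena := by
  obtain ⟨tG, ⟨⟨g⟩, -, lG, sG⟩, transG, treeG, incG, predG, succG, succG', labG, boxG⟩ := hG
  obtain ⟨tH, ⟨-, -, lH, sH⟩, transH, treeH, incH, predH, succH, succH', labH, boxH⟩ := hH
  have two : (G.gsum H).IsTwoColor := by
    refine ⟨?_, acyclic_sum (fun _ _ h => h) (fun _ _ h => h) ?_ tG.2 tH.2⟩
    · rintro (v | v) (w | w) ⟨h, h'⟩
      exacts [tG.1 _ _ ⟨h, h'⟩, h, h, tH.1 _ _ ⟨h, h'⟩]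
    · rintro x y (h | h) <;> exact h
  refine ⟨two, ⟨⟨Sum.inl g⟩, two.acyclic_iedge, ?_, ?_⟩, ?_, ?_, ?_, ?_, ?_, ?_, ?_, ?_⟩
  · rintro (a | a) (u | u) (w | w) (v | v) <;> simp only [LGraph.gsum, sumRel] <;> grind
  · rintro (a | a) (v | v) (w | w) (b | b) (u | u) <;> simp only [LGraph.gsum, sumRel] <;> grind
  · rintro (v | v) (w | w) (u | u) <;> simp only [LGraph.gsum, sumRel] <;> grind
  · rintro (v | v) (w | w) (u | u) <;> simp only [LGraph.gsum, sumRel] <;> grind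
  · rintro (v | v) (w | w) (u | u) <;> simp only [LGraph.gsum, sumRel] <;> grind
  · rintro (v | v) (w | w) (u | u) <;> simp only [LGraph.gsum, sumRel] <;> grind
  · rintro (v | v) (w | w) (u | u) <;> simp only [LGraph.gsum, sumRel] <;> grind
  · rintro (v | v) (w | w) (u | u) <;> simp only [LGraph.gsum, sumRel] <;> grind
  · rintro (v | v) (w | w) h
    exacts [labG _ _ h, h.elim, h.elim, labH _ _ h]
  · rintro (v | v) h
    · obtain ⟨w, hw⟩ := boxG v h
      exact ⟨Sum.inl w, hw⟩
    · obtain ⟨w, hw⟩ := boxH v h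
      exact ⟨Sum.inr w, hw⟩

/-- All out-neighbours of a vertex of an L-free graph are `→`-roots as soon as one is. -/
theorem IsArena.iRoot_of_iedge {G : LGraph} (h : G.IsArena) {a u w : G.V}
    (hu : G.iedge a u) (hw : G.iedge a w) (hr : G.iRoot u) : G.iRoot w :=
  fun v hv => hr v (h.2.2.1 a u w v hu hw hv)

theorem IsModalArena.iRoot_congr {G : LGraph} (h : G.IsModalArena) {v w : G.V}
    (hvw : G.medge v w) : G.iRoot v ↔ G.iRoot w := by
  obtain ⟨-, -, -, -, -, -, succ, succ', -⟩ := h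
  exact ⟨fun hv u hu => hv u (succ' v w u hvw hu), fun hw u hu => hw u (succ v w u hvw hu)⟩

section bef

variable {G H : LGraph}

theorem bef_iedge_inl_inl (x y : G.V) :
    (G.bef H).iedge (Sum.inl x) (Sum.inl y) ↔ G.iedge x y := by
  simp [bef, sumRel]

theorem bef_iedge_inr_inr (x y : H.V) :
    (G.bef H).iedge (Sum.inr x) (Sum.inr y) ↔ H.iedge x y := by
  simp [bef, sumRel]

theorem bef_iedge_inl_inr (x : G.V) (y : H.V) :
    (G.bef H).iedge (Sum.inl x) (Sum.inr y) ↔ G.iRoot x ∧ H.iRoot y := by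
  simp [bef, sumRel]

theorem not_bef_iedge_inr_inl (x : H.V) (y : G.V) :
    ¬ (G.bef H).iedge (Sum.inr x) (Sum.inl y) := by
  simp [bef, sumRel]

theorem bef_medge (v w : G.V ⊕ H.V) : (G.bef H).medge v w ↔ sumRel G.medge H.medge v w :=
  Iff.rfl

theorem IsModalArena.bef (hG : G.IsModalArena) (hH : H.IsModalArena) :
    (G.bef H).IsModalArena := by
  have rootG := fun v w => hG.iRoot_congr (v := v) (w := w)
  have rootH := fun v w => hH.iRoot_congr (v := v) (w := w)
  have sibG := fun a u w => hG.2.1.iRoot_of_iedge (a := a) (u := u) (w := w)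
  have sibH := fun a u w => hH.2.1.iRoot_of_iedge (a := a) (u := u) (w := w)
  have outG : ∀ v w, G.iRoot v → ¬ G.iedge v w := fun v w h => h w
  have outH : ∀ v w, H.iRoot v → ¬ H.iedge v w := fun v w h => h w
  obtain ⟨tG, ⟨⟨g⟩, -, lG, sG⟩, transG, treeG, incG, predG, succG, succG', labG, boxG⟩ := hG
  obtain ⟨tH, ⟨-, -, lH, sH⟩, transH, treeH, incH, predH, succH, succH', labH, boxH⟩ := hH
  have two : (G.bef H).IsTwoColor := by
    refine ⟨?_, acyclic_sum ?_ ?_ ?_ tG.2 tH.2⟩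
    · rintro (v | v) (w | w) ⟨h, h'⟩
      exacts [tG.1 _ _ ⟨(bef_iedge_inl_inl _ _).1 h, h'⟩, h', h',
        tH.1 _ _ ⟨(bef_iedge_inr_inr _ _).1 h, h'⟩]
    · exact fun x y h => h.imp_left (bef_iedge_inl_inl _ _).1
    · exact fun x y h => h.imp_left (bef_iedge_inr_inr _ _).1
    · exact fun x y h => h.elim (not_bef_iedge_inr_inl _ _) id
  refine ⟨two, ⟨⟨Sum.inl g⟩, two.acyclic_iedge, ?_, ?_⟩, ?_, ?_, ?_, ?_, ?_, ?_, ?_, ?_⟩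
  · rintro (a | a) (u | u) (w | w) (v | v) <;>
      simp only [bef_iedge_inl_inl, bef_iedge_inl_inr, bef_iedge_inr_inr,
        not_bef_iedge_inr_inl] <;> grind
  · rintro (a | a) (v | v) (w | w) (b | b) (u | u) <;>
      simp only [bef_iedge_inl_inl, bef_iedge_inl_inr, bef_iedge_inr_inr,
        not_bef_iedge_inr_inl] <;> grind
  · rintro (v | v) (w | w) (u | u) <;> simp only [bef_medge, sumRel] <;> grind
  · rintro (v | v) (w | w) (u | u) <;> simp only [bef_medge, sumRel] <;> grind
  all_goals try
    rintro (v | v) (w | w) (u | u) <;>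
      simp only [bef_medge, sumRel, bef_iedge_inl_inl, bef_iedge_inl_inr, bef_iedge_inr_inr,
        not_bef_iedge_inr_inl] <;> grind
  · rintro (v | v) (w | w) h
    exacts [labG _ _ h, h.elim, h.elim, labH _ _ h]
  · rintro (v | v) h
    · obtain ⟨w, hw⟩ := boxG v h
      exact ⟨Sum.inl w, hw⟩
    · obtain ⟨w, hw⟩ := boxH v h
      exact ⟨Sum.inr w, hw⟩

end bef

section mbef

variable {l : MLabel} {G : LGraph}

theorem single_mbef_medge_inl_inr (x : (single l).V) (y : G.V) :
    ((single l).mbef G).medge (Sum.inl x) (Sum.inr y) ↔ G.iRoot y := by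
  refine ⟨?_, fun h => Or.inr ⟨x, y, rfl, rfl, fun _ => id, h⟩⟩
  rintro (h | ⟨x', y', -, hy, -, h⟩)
  · exact h.elim
  · cases hy
    exact h

theorem single_mbef_medge_inr_inr (x y : G.V) :
    ((single l).mbef G).medge (Sum.inr x) (Sum.inr y) ↔ G.medge x y := by
  simp [mbef, sumRel]

theorem not_single_mbef_medge_inl (x : (single l).V ⊕ G.V) (y : (single l).V) :
    ¬ ((single l).mbef G).medge x (Sum.inl y) := by
  cases x <;> simp [mbef, sumRel, single]

theorem single_mbef_iedge_inr_inr (x y : G.V) :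
    ((single l).mbef G).iedge (Sum.inr x) (Sum.inr y) ↔ G.iedge x y :=
  Iff.rfl

theorem not_single_mbef_iedge_to_inl (x : (single l).V ⊕ G.V) (y : (single l).V) :
    ¬ ((single l).mbef G).iedge x (Sum.inl y) := by
  cases x <;> simp [mbef, sumRel, single]

theorem not_single_mbef_iedge_from_inl (x : (single l).V) (y : (single l).V ⊕ G.V) :
    ¬ ((single l).mbef G).iedge (Sum.inl x) y := by
  cases y <;> simp [mbef, sumRel, single]

theorem IsModalArena.single_mbef (hG : G.IsModalArena) (hr : ∃ v, G.iRoot v)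
    (hl : l = MLabel.box ∨ l = MLabel.dia) : ((single l).mbef G).IsModalArena := by
  have root := fun v w => hG.iRoot_congr (v := v) (w := w)
  have out : ∀ v w, G.iRoot v → ¬ G.iedge v w := fun v w h => h w
  obtain ⟨r, hr⟩ := hr
  obtain ⟨t, ⟨-, -, lG, sG⟩, trans, tree, inc, pred, succ, succ', lab, box⟩ := hG
  have two : ((single l).mbef G).IsTwoColor := by
    refine ⟨?_, acyclic_sum (r := fun _ _ => False) ?_ ?_ ?_ ?_ t.2⟩
    · rintro (v | v) (w | w) ⟨h, h'⟩
      exacts [h, h, h, t.1 _ _ ⟨h, (single_mbef_medge_inr_inr _ _).1 h'⟩]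
    · exact fun x y h =>
        h.elim (not_single_mbef_iedge_to_inl _ _) (not_single_mbef_medge_inl _ _)
    · exact fun x y h => h.imp_right (single_mbef_medge_inr_inr _ _).1
    · exact fun x y h =>
        h.elim (not_single_mbef_iedge_to_inl _ _) (not_single_mbef_medge_inl _ _)
    · exact fun v h => by cases h <;> assumption
  refine ⟨two, ⟨⟨Sum.inr r⟩, two.acyclic_iedge, ?_, ?_⟩, ?_, ?_, ?_, ?_, ?_, ?_, ?_, ?_⟩
  · rintro (a | a) (u | u) (w | w) (v | v) <;>
      simp only [single_mbef_iedge_inr_inr, not_single_mbef_iedge_to_inl,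
        not_single_mbef_iedge_from_inl] <;>
      grind
  · rintro (a | a) (v | v) (w | w) (b | b) (u | u) <;>
      simp only [single_mbef_iedge_inr_inr, not_single_mbef_iedge_to_inl,
        not_single_mbef_iedge_from_inl] <;>
      grind
  · rintro (v | v) (w | w) (u | u) <;>
      simp only [single_mbef_medge_inl_inr, single_mbef_medge_inr_inr, not_single_mbef_medge_inl] <;>
      grind
  · rintro (v | v) (w | w) (u | u) h h'
    · exact (not_single_mbef_medge_inl _ _ h).elim
    · exact (not_single_mbef_medge_inl _ _ h).elim
    · exact Or.inr (Or.inr rfl)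
    · have hw := (single_mbef_medge_inl_inr _ _).1 h
      rw [single_mbef_medge_inr_inr] at h'
      exact Or.inr (Or.inl ((single_mbef_medge_inl_inr _ _).2 ((root _ _ h').2 hw)))
    · exact (not_single_mbef_medge_inl _ _ h).elim
    · exact (not_single_mbef_medge_inl _ _ h).elim
    · have hw := (single_mbef_medge_inl_inr _ _).1 h'
      rw [single_mbef_medge_inr_inr] at h
      exact Or.inl ((single_mbef_medge_inl_inr _ _).2 ((root _ _ h).2 hw))
    · rw [single_mbef_medge_inr_inr] at h h'
      exact (tree v w u h h').imp (single_mbef_medge_inr_inr _ _).2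
        (Or.imp (single_mbef_medge_inr_inr _ _).2 (congrArg Sum.inr))
  · rintro (v | v) (w | w) (u | u) <;>
      simp only [single_mbef_medge_inl_inr, single_mbef_medge_inr_inr, not_single_mbef_medge_inl,
        single_mbef_iedge_inr_inr, not_single_mbef_iedge_to_inl, not_single_mbef_iedge_from_inl] <;>
      grind
  · rintro (v | v) (w | w) (u | u) <;>
      simp only [single_mbef_medge_inl_inr, single_mbef_medge_inr_inr, not_single_mbef_medge_inl,
        single_mbef_iedge_inr_inr, not_single_mbef_iedge_to_inl, not_single_mbef_iedge_from_inl] <;>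
      grind
  · rintro (v | v) (w | w) (u | u) <;>
      simp only [single_mbef_medge_inl_inr, single_mbef_medge_inr_inr, not_single_mbef_medge_inl,
        single_mbef_iedge_inr_inr, not_single_mbef_iedge_to_inl, not_single_mbef_iedge_from_inl] <;>
      grind
  · rintro (v | v) (w | w) (u | u) <;>
      simp only [single_mbef_medge_inl_inr, single_mbef_medge_inr_inr, not_single_mbef_medge_inl,
        single_mbef_iedge_inr_inr, not_single_mbef_iedge_to_inl, not_single_mbef_iedge_from_inl] <;>
      grind
  · rintro (v | v) (w | w) h
    exacts [hl, hl, (not_single_mbef_medge_inl _ _ h).elim,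
      lab _ _ ((single_mbef_medge_inr_inr _ _).1 h)]
  · rintro (v | v) h
    · exact ⟨Sum.inr r, (single_mbef_medge_inl_inr _ _).2 hr⟩
    · obtain ⟨w, hw⟩ := box v h
      exact ⟨Sum.inr w, (single_mbef_medge_inr_inr _ _).2 hw⟩

end mbef

end LGraph

theorem MForm.exists_iRoot_arena (F : MForm) : ∃ v, F.arena.iRoot v := by
  induction F with
  | atom a => exact ⟨(), fun _ h => h⟩
  | diaBot => exact ⟨(), fun _ h => h⟩
  | conj A B ihA ihB =>
    obtain ⟨v, hv⟩ := ihA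
    exact ⟨Sum.inl v, by rintro (w | w) h; exacts [hv w h, h]⟩
  | imp A B ihA ihB =>
    obtain ⟨v, hv⟩ := ihB
    refine ⟨Sum.inr v, ?_⟩
    rintro (w | w) h
    exacts [LGraph.not_bef_iedge_inr_inl _ _ h, hv w ((LGraph.bef_iedge_inr_inr _ _).1 h)]
  | box A ih => exact ⟨Sum.inl (), LGraph.not_single_mbef_iedge_from_inl _⟩
  | dia A ih => exact ⟨Sum.inl (), LGraph.not_single_mbef_iedge_from_inl _⟩

/-- For every modal formula `F`, the `L`-labeled two-color
DAG `[[F]]` is a modal arena. -/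
theorem statement_6 (F : MForm) : F.arena.IsModalArena := by
  induction F with
  | atom a => exact LGraph.isModalArena_single (by simp)
  | diaBot => exact LGraph.isModalArena_single (by simp)
  | conj A B ihA ihB => exact ihA.gsum ihB
  | imp A B ihA ihB => exact ihA.bef ihB
  | box A ih => exact ih.single_mbef A.exists_iRoot_arena (Or.inl rfl)
  | dia A ih => exact ih.single_mbef A.exists_iRoot_arena (Or.inr rfl)
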